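/- Let a and b be two distinct agents. For every call sequence σ: σ ∼_{{a,b}} ε if and only if the call ab does not occur in σ. -/

import Mathlib

namespace Gossip

/-- A call between two distinct agents. -/
structure Call (A : Type) where
  x : A
  y : A
  ne : x ≠ y

variable {A : Type} [DecidableEq A]

/-- Agent `a` is involved in the call `c`. -/
def Call.involves (c : Call A) (a : A) : Prop := a = c.x ∨ a = c.y

instance (c : Call A) (a : A) : Decidable (c.involves a) := by
  unfold Call.involves; infer_instance

/-- `c` is the call between agents `a` and `b`. -/
def Call.isBetween (c : Call A) (a b : A) : Prop :=
  (c.x = a ∧ c.y = b) ∨ (c.x = b ∧ c.y = a)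

instance (c : Call A) (a b : A) : Decidable (c.isBetween a b) := by
  unfold Call.isBetween; infer_instance

/-- The effect of a call on a gossip situation: the two agents involved
pool their secrets. -/
def Call.apply (c : Call A) (s : A → Finset A) : A → Finset A :=
  fun d => if d = c.x ∨ d = c.y then s c.x ∪ s c.y else s d

/-- The initial gossip situation: each agent is familiar only with their
own secret (secrets are identified with agents via the fixed bijection). -/
def root : A → Finset A := fun a => {a}

/-- The result of applying a call sequence to a gossip situation. -/
def applySeq (σ : List (Call A)) (s : A → Finset A) : A → Finset A :=
  σ.foldl (fun t c => c.apply t) s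

/-- `∼_a` : the smallest relation with `ε ∼_a ε`, closed under appending
calls not involving `a` on either side, and under appending a call
involving `a` on both sides when it yields the same set of secrets for `a`. -/
inductive AgEquiv (a : A) : List (Call A) → List (Call A) → Prop
  | nil : AgEquiv a [] []
  | extLeft {σ τ : List (Call A)} (c : Call A) :
      ¬ c.involves a → AgEquiv a σ τ → AgEquiv a (σ ++ [c]) τ
  | extRight {σ τ : List (Call A)} (c : Call A) :
      ¬ c.involves a → AgEquiv a σ τ → AgEquiv a σ (τ ++ [c])
  | call {σ τ : List (Call A)} (c : Call A) :
      c.involves a →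
      applySeq (σ ++ [c]) root a = applySeq (τ ++ [c]) root a →
      AgEquiv a σ τ → AgEquiv a (σ ++ [c]) (τ ++ [c])

/-- `∼_G` : reflexive-transitive closure of the union of the `∼_a`, `a ∈ G`. -/
def GEquiv (G : Finset A) : List (Call A) → List (Call A) → Prop :=
  Relation.ReflTransGen (fun σ τ => ∃ a ∈ G, AgEquiv a σ τ)

/-- Formulas of the language `L^ck`. `fam a p` is `F_a p`,
`ck G φ` is `C_G φ`; `K_a φ` is `ck {a} φ`. -/
inductive Formula (A : Type) where
  | fam : A → A → Formula A
  | neg : Formula A → Formula A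
  | conj : Formula A → Formula A → Formula A
  | ck : Finset A → Formula A → Formula A

/-- Truth of a formula at a call sequence (in the gossip model). -/
def Sat : Formula A → List (Call A) → Prop
  | .fam a p, σ => p ∈ applySeq σ root a
  | .neg φ, σ => ¬ Sat φ σ
  | .conj φ ψ, σ => Sat φ σ ∧ Sat ψ σ
  | .ck G φ, σ => ∀ τ, GEquiv G σ τ → Sat φ τ

/-- `M ⊨ φ` : truth at every call sequence. -/
def Truth (φ : Formula A) : Prop := ∀ σ : List (Call A), Sat φ σ

/-- Formulas with no occurrence of the negation symbol. -/
def NegFree : Formula A → Prop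
  | .fam _ _ => True
  | .neg _ => False
  | .conj φ ψ => NegFree φ ∧ NegFree ψ
  | .ck _ φ => NegFree φ

/-- Formulas with no occurrence of the `C_G` modalities (propositional part). -/
def CkFree : Formula A → Prop
  | .fam _ _ => True
  | .neg φ => CkFree φ
  | .conj φ ψ => CkFree φ ∧ CkFree ψ
  | .ck _ _ => False

/-- Formulas of `L_wn`: no nested occurrence of the `C_G` modalities. -/
def NoNested : Formula A → Prop
  | .fam _ _ => True
  | .neg φ => NoNested φ
  | .conj φ ψ => NoNested φ ∧ NoNested ψ
  | .ck _ φ => CkFree φ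

/-- The call `ab` occurs in `σ`. -/
def occursBetween (a b : A) (σ : List (Call A)) : Prop :=
  ∃ c ∈ σ, c.isBetween a b

/-- Epistemic pair-view component `Ṽ(σ)(a,b)`. -/
def pairView (σ : List (Call A)) (a b : A) : Set (A → Finset A) :=
  {s | ∃ τ, GEquiv {a, b} σ τ ∧ s = applySeq τ root}

/-- The full epistemic pair-view `Ṽ(σ)` : all components `Ṽ(σ)(a,b)`
together with the designated situation `Ṽ(σ)(*) = σ(root)`. -/
def fullView (σ : List (Call A)) : (A → A → Set (A → Finset A)) × (A → Finset A) :=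
  (pairView σ, applySeq σ root)

/-- A call sequence is pair-epistemically non-redundant if no nonempty
subsequence `σ₂` of a prefix `σ₁.σ₂` is pair-epistemically redundant. -/
def PairNonRedundant (σ : List (Call A)) : Prop :=
  ∀ σ₁ σ₂ : List (Call A), (σ₁ ++ σ₂) <+: σ → σ₂ ≠ [] →
    fullView σ₁ ≠ fullView (σ₁ ++ σ₂)

/-- Order on gossip situations: componentwise inclusion. -/
def gsLE (s t : A → Finset A) : Prop := ∀ a, s a ⊆ t a

/-- The order `≤_EPV` on (the pair components of) epistemic pair-views. -/
def epvLE (V W : A → A → Set (A → Finset A)) : Prop :=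
  ∀ a b : A, ∃ X : Set (A → Finset A), X ⊆ V a b ∧
    ∃ g : X → W a b, Function.Surjective g ∧ ∀ s : X, gsLE s.1 (g s).1

/-- `σ` is ab-redundant free: no call of `σ` different from the call `ab`
is redundant (leaves the current gossip situation unchanged). -/
def abRedundantFree (a b : A) (σ : List (Call A)) : Prop :=
  ∀ (i : ℕ) (h : i < σ.length), ¬ (σ.get ⟨i, h⟩).isBetween a b →
    (σ.get ⟨i, h⟩).apply (applySeq (σ.take i) root) ≠ applySeq (σ.take i) root

theorem AgEquiv.refl {A : Type} [DecidableEq A] (a : A) (σ : List (Call A)) :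
    AgEquiv a σ σ := by
  induction σ using List.reverseRecOn with
  | nil => exact .nil
  | append_singleton σ c ih =>
    by_cases hc : c.involves a
    · exact .call c hc rfl ih
    · exact .extLeft c hc (.extRight c hc ih)

/-- Agent `a` is aware of every call it takes part in. -/
theorem AgEquiv.mem_iff {A : Type} [DecidableEq A] {a : A} {σ τ : List (Call A)}
    (h : AgEquiv a σ τ) {d : Call A} (hd : d.involves a) : d ∈ σ ↔ d ∈ τ := by
  induction h with
  | nil => rfl
  | extLeft c hc _ ih =>
    have hne : d ≠ c := fun h => hc (h ▸ hd)
    simp [hne, ih]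
  | extRight c hc _ ih =>
    have hne : d ≠ c := fun h => hc (h ▸ hd)
    simp [hne, ih]
  | call c _ _ _ ih => simp [ih]

theorem Call.isBetween.involves {A : Type} {a b e : A} {c : Call A}
    (h : c.isBetween a b) (he : e = a ∨ e = b) : c.involves e := by
  unfold Call.isBetween at h
  unfold Call.involves
  grind

theorem Call.isBetween_of_involves {A : Type} {a b : A} (hab : a ≠ b) {c : Call A}
    (ha : c.involves a) (hb : c.involves b) : c.isBetween a b := by
  unfold Call.involves at ha hb
  unfold Call.isBetween
  grind

theorem GEquiv.occursBetween_iff {A : Type} [DecidableEq A] {a b : A}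
    {σ τ : List (Call A)} (h : GEquiv {a, b} σ τ) :
    occursBetween a b σ ↔ occursBetween a b τ := by
  induction h with
  | refl => rfl
  | tail _ hstep ih =>
    obtain ⟨e, he, hequiv⟩ := hstep
    have he' : e = a ∨ e = b := by simpa using he
    exact ih.trans (exists_congr fun _ =>
      and_congr_left fun hc => hequiv.mem_iff (hc.involves he'))

theorem GEquiv.nil_of_not_occursBetween {A : Type} [DecidableEq A] {a b : A}
    (hab : a ≠ b) {σ : List (Call A)} (h : ¬ occursBetween a b σ) :
    GEquiv {a, b} σ [] := by
  induction σ using List.reverseRecOn with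
  | nil => exact .refl
  | append_singleton σ c ih =>
    have hσ : ¬ occursBetween a b σ := fun ⟨d, hd, hdab⟩ => h ⟨d, by simp [hd], hdab⟩
    have hc : ¬ c.isBetween a b := fun hcab => h ⟨c, by simp, hcab⟩
    refine .head ?_ (ih hσ)
    by_cases ha : c.involves a
    · exact ⟨b, by simp, .extLeft c (fun hb => hc (Call.isBetween_of_involves hab ha hb))
        (.refl b σ)⟩
    · exact ⟨a, by simp, .extLeft c ha (.refl a σ)⟩

theorem stmt3 {A : Type} [DecidableEq A] [Fintype A] (hA : 3 ≤ Fintype.card A)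
    (a b : A) (hab : a ≠ b) (σ : List (Call A)) :
    GEquiv {a, b} σ [] ↔ ¬ occursBetween a b σ := by
  refine ⟨fun h hocc => ?_, GEquiv.nil_of_not_occursBetween hab⟩
  obtain ⟨c, hc, -⟩ := h.occursBetween_iff.mp hocc
  simp at hc

end Gossip
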